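/- Let w : ℝ × ℝ → ℝ be a smooth nowhere-zero function satisfying the KdV eigenfunction equation w_t = w_xxx − 3 w_x w_xx / w at every point. Then the function v := w_x / w satisfies the mKdV equation v_t = v_xxx − 6 v² v_x at every point. -/

import Mathlib

/-- Partial derivative with respect to the first (space) variable. -/
noncomputable def px (f : ℝ × ℝ → ℝ) : ℝ × ℝ → ℝ :=
  fun p => deriv (fun x => f (x, p.2)) p.1

/-- Partial derivative with respect to the second (time) variable. -/
noncomputable def pt (f : ℝ × ℝ → ℝ) : ℝ × ℝ → ℝ :=
  fun p => deriv (fun t => f (p.1, t)) p.2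

open scoped ContDiff

theorem hasDerivAt_px {f : ℝ × ℝ → ℝ} (hf : Differentiable ℝ f) (p : ℝ × ℝ) :
    HasDerivAt (fun x => f (x, p.2)) (px f p) p.1 := by
  have h : DifferentiableAt ℝ (fun x => f (x, p.2)) p.1 := by fun_prop
  exact h.hasDerivAt

theorem hasDerivAt_pt {f : ℝ × ℝ → ℝ} (hf : Differentiable ℝ f) (p : ℝ × ℝ) :
    HasDerivAt (fun t => f (p.1, t)) (pt f p) p.2 := by
  have h : DifferentiableAt ℝ (fun t => f (p.1, t)) p.2 := by fun_prop
  exact h.hasDerivAt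

theorem px_eq_fderiv {f : ℝ × ℝ → ℝ} (hf : Differentiable ℝ f) :
    px f = fun p => fderiv ℝ f p (1, 0) := by
  funext p
  exact ((hf p).hasFDerivAt.comp_hasDerivAt p.1
    ((hasDerivAt_id p.1).prodMk (hasDerivAt_const p.1 p.2))).deriv

theorem pt_eq_fderiv {f : ℝ × ℝ → ℝ} (hf : Differentiable ℝ f) :
    pt f = fun p => fderiv ℝ f p (0, 1) := by
  funext p
  exact ((hf p).hasFDerivAt.comp_hasDerivAt p.2
    ((hasDerivAt_const p.2 p.1).prodMk (hasDerivAt_id p.2))).deriv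

theorem ContDiff.px {f : ℝ × ℝ → ℝ} (hf : ContDiff ℝ ∞ f) : ContDiff ℝ ∞ (px f) := by
  rw [px_eq_fderiv (hf.differentiable (by simp))]
  exact (hf.fderiv_right (by simp)).clm_apply contDiff_const

/-- Equality of mixed partial derivatives. -/
theorem pt_px_comm {f : ℝ × ℝ → ℝ} (hf : ContDiff ℝ ∞ f) : pt (px f) = px (pt f) := by
  have hd : Differentiable ℝ f := hf.differentiable (by simp)
  have hd' : Differentiable ℝ (fderiv ℝ f) :=
    (hf.fderiv_right (m := ∞) (by simp)).differentiable (by simp)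
  have second (u v p : ℝ × ℝ) :
      fderiv ℝ (fun q => fderiv ℝ f q u) p v = fderiv ℝ (fderiv ℝ f) p v u := by
    rw [fderiv_clm_apply (hd' p) (differentiableAt_const u)]
    simp
  rw [px_eq_fderiv hd, pt_eq_fderiv hd, pt_eq_fderiv (by fun_prop), px_eq_fderiv (by fun_prop)]
  funext p
  rw [second, second]
  exact (hf.contDiffAt.isSymmSndFDerivAt
    (by
      rw [minSmoothness_of_isRCLikeNormedField]
      exact WithTop.coe_le_coe.2 (le_top (a := (2 : ℕ∞))))) _ _

theorem px_mul {f g : ℝ × ℝ → ℝ} (hf : Differentiable ℝ f) (hg : Differentiable ℝ g)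
    (p : ℝ × ℝ) : px (fun q => f q * g q) p = px f p * g p + f p * px g p :=
  ((hasDerivAt_px hf p).fun_mul (hasDerivAt_px hg p)).deriv

theorem pt_mul {f g : ℝ × ℝ → ℝ} (hf : Differentiable ℝ f) (hg : Differentiable ℝ g)
    (p : ℝ × ℝ) : pt (fun q => f q * g q) p = pt f p * g p + f p * pt g p :=
  ((hasDerivAt_pt hf p).fun_mul (hasDerivAt_pt hg p)).deriv

/-- If `w` is smooth, nowhere zero, and satisfies the KdV eigenfunction equation
`w_t = w_xxx - 3 w_x w_xx / w`, then `v := w_x / w` satisfies the mKdV equation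
`v_t = v_xxx - 6 v² v_x`. -/
theorem coleHopf_kdvEigenfunction_to_mkdv
    (w : ℝ × ℝ → ℝ) (hw : ContDiff ℝ (⊤ : ℕ∞) w) (hw0 : ∀ p, w p ≠ 0)
    (heq : ∀ p, pt w p = px (px (px w)) p - 3 * px w p * px (px w) p / w p) :
    ∀ p, pt (fun q => px w q / w q) p =
      px (px (px (fun q => px w q / w q))) p -
        6 * (px w p / w p) ^ 2 * px (fun q => px w q / w q) p := by
  suffices H : ∀ v : ℝ × ℝ → ℝ, ContDiff ℝ ∞ v → (∀ p, px w p = v p * w p) →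
      ∀ p, pt v p = px (px (px v)) p - 6 * v p ^ 2 * px v p from
    H _ (hw.px.div hw hw0) fun p => (div_mul_cancel₀ _ (hw0 p)).symm
  intro v hv hwv
  have hw' : Differentiable ℝ w := hw.differentiable (by simp)
  have hv' : Differentiable ℝ v := hv.differentiable (by simp)
  have hv1 : Differentiable ℝ (px v) := hv.px.differentiable (by simp)
  have hv2 : Differentiable ℝ (px (px v)) := hv.px.px.differentiable (by simp)
  have w1 : px w = fun p => v p * w p := funext hwv
  have w2 : px (px w) = fun p => (px v p + v p ^ 2) * w p := by
    funext p
    rw [w1, px_mul hv' hw', hwv]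
    ring
  have w3 (p : ℝ × ℝ) :
      px (px (px w)) p = (px (px v) p + 3 * v p * px v p + v p ^ 3) * w p := by
    have h := ((hasDerivAt_px hv1 p).fun_add ((hasDerivAt_px hv' p).fun_pow 2)).fun_mul
      (hasDerivAt_px hw' p)
    rw [w2]
    refine h.deriv.trans ?_
    rw [hwv]
    push_cast
    ring
  have wt : pt w = fun p => (px (px v) p - 2 * v p ^ 3) * w p := by
    funext p
    have := hw0 p
    rw [heq, w3, w2, hwv]
    field_simp
    ring
  have wtx (p : ℝ × ℝ) : px (pt w) p =
      (px (px (px v)) p - 6 * v p ^ 2 * px v p + v p * (px (px v) p - 2 * v p ^ 3)) * w p := by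
    have h := ((hasDerivAt_px hv2 p).fun_sub
      (((hasDerivAt_px hv' p).fun_pow 3).const_mul 2)).fun_mul (hasDerivAt_px hw' p)
    rw [wt]
    refine h.deriv.trans ?_
    rw [hwv]
    push_cast
    ring
  intro p
  have key := congrFun (pt_px_comm hw) p
  rw [wtx, w1, pt_mul hv' hw', wt] at key
  apply mul_right_cancel₀ (hw0 p)
  linear_combination key
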